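/- Extend each W̃_{μ,i} to the nodes by setting W̃_{μ,i}(x_k) = δ_{ik} (its limit value). Then for all integers α, β ≥ 0 with 1 ≤ α+β < μ and all i, k ∈ {1,…,N}, the partial derivative ∂^{α+β}W̃_{μ,i}/∂x^α∂y^β exists at x_k and equals 0. -/

import Mathlib

open Filter Finset
open scoped BigOperators Topology Classical

noncomputable section

abbrev E2 : Type := EuclideanSpace ℝ (Fin 2)

def e0 : E2 := EuclideanSpace.single 0 1
def e1 : E2 := EuclideanSpace.single 1 1

/-- Directional derivative of `f` along `v`. -/
def Dv (v : E2) (f : E2 → ℝ) : E2 → ℝ := fun x => fderiv ℝ f x v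

/-- Partial derivative `∂^{a+b} f / ∂x^a ∂y^b`. -/
def pd (a b : ℕ) (f : E2 → ℝ) : E2 → ℝ := (Dv e0)^[a] ((Dv e1)^[b] f)

/-- The Franke–Little/Renka local weight
`W_{μ,j}(x) = (max(1/‖x - x_j‖ - 1/R_j, 0))^μ`. -/
def Wloc (N : ℕ) (p : Fin N → E2) (R : Fin N → ℝ) (μ : ℝ) (j : Fin N) (x : E2) : ℝ :=
  (max (1 / ‖x - p j‖ - 1 / R j) 0) ^ μ

/-- The local Shepard basis function `W̃_{μ,i}` extended to the nodes by its limit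
(Kronecker delta) values. -/
def WtExt (N : ℕ) (p : Fin N → E2) (R : Fin N → ℝ) (μ : ℝ) (i : Fin N) (x : E2) : ℝ :=
  if x = p i then 1
  else if ∃ k, x = p k then 0
  else Wloc N p R μ i x / ∑ k, Wloc N p R μ k x

section SymB
variable {E F : Type} [NormedAddCommGroup E] [NormedSpace ℝ E]
  [NormedAddCommGroup F] [NormedSpace ℝ F]

/-- Symbol class of order `s` at the point `a`, with control of `n` derivatives. -/
def SymB (a : E) (s : ℝ) (n : ℕ) (f : E → F) : Prop :=
  ∃ C : ℝ, 0 ≤ C ∧ ∀ᶠ x in 𝓝[≠] a, ContDiffAt ℝ n f x ∧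
    ∀ l ≤ n, ‖iteratedFDeriv ℝ l f x‖ ≤ C * ‖x - a‖ ^ (s - l)

theorem smul_bound {n : ℕ} {f : E → ℝ} {g : E → F} {x : E}
    (hf : ContDiffAt ℝ n f x) (hg : ContDiffAt ℝ n g x) :
    ‖iteratedFDeriv ℝ n (fun y => f y • g y) x‖ ≤ ∑ i ∈ Finset.range (n + 1),
      (n.choose i : ℝ) * ‖iteratedFDeriv ℝ i f x‖ * ‖iteratedFDeriv ℝ (n - i) g x‖ := by
  have h1 := hf.eventually (by simp)
  have h2 := hg.eventually (by simp)
  obtain ⟨u, hu, huo, hxu⟩ := eventually_nhds_iff.1 (h1.and h2)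
  have := norm_iteratedFDerivWithin_smul_le (𝕜 := ℝ) (s := u) (f := f) (g := g) (N := n) (n := n)
    (fun y hy => (hu y hy).1.contDiffWithinAt) (fun y hy => (hu y hy).2.contDiffWithinAt)
    huo.uniqueDiffOn hxu le_rfl
  simpa only [iteratedFDerivWithin_of_isOpen _ huo hxu] using this

theorem SymB.smul {a : E} {s t : ℝ} {n : ℕ} {f : E → ℝ} {g : E → F}
    (hf : SymB a s n f) (hg : SymB a t n g) : SymB a (s + t) n (fun x => f x • g x) := by
  obtain ⟨C, hC, hf⟩ := hf
  obtain ⟨D, hD, hg⟩ := hg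
  refine ⟨2 ^ n * (C * D), by positivity, ?_⟩
  filter_upwards [hf, hg, self_mem_nhdsWithin] with x hx hy hne
  refine ⟨hx.1.smul hy.1, fun l hl => ?_⟩
  have hl' : ((l : ℕ) : WithTop ℕ∞) ≤ n := by exact_mod_cast hl
  have hr : 0 < ‖x - a‖ := norm_pos_iff.2 (sub_ne_zero.2 hne)
  refine (smul_bound (hx.1.of_le hl') (hy.1.of_le hl')).trans ?_
  calc _ ≤ ∑ i ∈ Finset.range (l + 1), (l.choose i : ℝ) * (C * D * ‖x - a‖ ^ (s + t - l)) := by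
        refine Finset.sum_le_sum fun i hi => ?_
        have hi' : i ≤ l := by simpa [Nat.lt_succ_iff] using hi
        rw [mul_assoc]
        refine mul_le_mul_of_nonneg_left ?_ (by positivity)
        have e : s + t - l = (s - i) + (t - ((l - i : ℕ) : ℝ)) := by
          rw [Nat.cast_sub hi']; ring
        rw [e, Real.rpow_add hr]
        calc _ ≤ (C * ‖x - a‖ ^ (s - i)) * (D * ‖x - a‖ ^ (t - ((l - i : ℕ) : ℝ))) :=
              mul_le_mul (hx.2 i (hi'.trans hl)) (hy.2 _ ((Nat.sub_le _ _).trans hl))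
                (norm_nonneg _) (by positivity)
          _ = _ := by ring
    _ = 2 ^ l * (C * D) * ‖x - a‖ ^ (s + t - l) := by
        rw [← Finset.sum_mul]
        have : ∑ i ∈ Finset.range (l + 1), (l.choose i : ℝ) = 2 ^ l := by
          exact_mod_cast Nat.sum_range_choose l
        rw [this]; ring
    _ ≤ _ := by
        gcongr
        norm_num

theorem nhdsNE_nhds {a : E} {P : E → Prop} (h : ∀ᶠ x in 𝓝[≠] a, P x) :
    ∀ᶠ x in 𝓝[≠] a, ∀ᶠ y in 𝓝 x, P y :=
  (eventually_nhdsWithin_eventually_nhds_iff_of_isOpen isOpen_compl_singleton).2 h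

theorem SymB.of_fderiv {a : E} {s : ℝ} {n : ℕ} {f : E → F} {f' : E → E →L[ℝ] F}
    (hd : ∀ᶠ x in 𝓝[≠] a, HasFDerivAt f (f' x) x) (h : SymB a (s - 1) n f')
    {C : ℝ} (hC : ∀ᶠ x in 𝓝[≠] a, ‖f x‖ ≤ C * ‖x - a‖ ^ s) : SymB a s (n + 1) f := by
  obtain ⟨D, hD, h⟩ := h
  refine ⟨max C D, le_max_of_le_right hD, ?_⟩
  filter_upwards [nhdsNE_nhds hd, h, hC] with x hx h hC
  refine ⟨?_, ?_⟩
  · have := (contDiffAt_succ_iff_hasFDerivAt (𝕜 := ℝ) (f := f) (x := x) (n := n)).2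
      ⟨f', ⟨_, hx, fun y hy => hy⟩, h.1⟩
    exact_mod_cast this
  · intro l hl
    rcases l with _ | l
    · simp only [norm_iteratedFDeriv_zero, Nat.cast_zero, sub_zero]
      refine hC.trans ?_
      gcongr
      exact le_max_left _ _
    · rw [← norm_iteratedFDeriv_fderiv]
      have e : fderiv ℝ f =ᶠ[𝓝 x] f' := hx.mono fun y hy => hy.fderiv
      rw [(e.iteratedFDeriv ℝ l).self_of_nhds]
      refine (h.2 l (by omega)).trans ?_
      have : s - 1 - l = s - ((l + 1 : ℕ) : ℝ) := by push_cast; ring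
      rw [this]
      gcongr
      exact le_max_right _ _

theorem SymB.zero_of_bound {a : E} {s : ℝ} {f : E → F} {C : ℝ} (hC0 : 0 ≤ C)
    (hc : ∀ᶠ x in 𝓝[≠] a, ContinuousAt f x)
    (hC : ∀ᶠ x in 𝓝[≠] a, ‖f x‖ ≤ C * ‖x - a‖ ^ s) : SymB a s 0 f := by
  refine ⟨C, hC0, ?_⟩
  filter_upwards [nhdsNE_nhds hc, hC] with x hx hC
  refine ⟨?_, ?_⟩
  · refine contDiffAt_zero.2 ⟨_, hx, fun y hy => ContinuousAt.continuousWithinAt hy⟩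
  · intro l hl
    obtain rfl : l = 0 := by omega
    simpa using hC

theorem SymB.fderiv {a : E} {s : ℝ} {n : ℕ} {f : E → F} (h : SymB a s (n + 1) f) :
    SymB a (s - 1) n (fderiv ℝ f) := by
  obtain ⟨C, hC, h⟩ := h
  refine ⟨C, hC, ?_⟩
  filter_upwards [h] with x hx
  refine ⟨hx.1.fderiv_right (by norm_cast), fun l hl => ?_⟩
  rw [norm_iteratedFDeriv_fderiv]
  convert hx.2 (l + 1) (by omega) using 3
  push_cast; ring

theorem SymB.const (a : E) (n : ℕ) (c : F) : SymB a 0 n (fun _ => c) := by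
  refine ⟨‖c‖, norm_nonneg _, Eventually.of_forall fun x => ⟨contDiffAt_const, ?_⟩⟩
  intro l hl
  rcases l with _ | l
  · simp
  · rw [iteratedFDeriv_succ_const]
    simp only [Pi.zero_apply, norm_zero]
    positivity

/-- Flatness. -/
def Flat (a : E) (n : ℕ) (f : E → F) : Prop :=
  ContDiffAt ℝ n f a ∧ ∀ l ≤ n, iteratedFDeriv ℝ l f a = 0

theorem tendsto_aux {a : E} {s : ℝ} (hs : 0 < s) (C : ℝ) :
    Tendsto (fun x : E => C * ‖x - a‖ ^ s) (𝓝 a) (𝓝 0) := by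
  have : ContinuousAt (fun x : E => C * ‖x - a‖ ^ s) a := by
    refine ContinuousAt.mul continuousAt_const ?_
    exact ContinuousAt.rpow_const (by fun_prop) (Or.inr hs.le)
  have h2 := this.tendsto
  simpa [Real.zero_rpow hs.ne'] using h2

theorem bound_full {a : E} {s : ℝ} {C : ℝ} {f : E → F} (h0 : f a = 0) (hC : 0 ≤ C)
    (h : ∀ᶠ x in 𝓝[≠] a, ‖f x‖ ≤ C * ‖x - a‖ ^ s) : ∀ᶠ x in 𝓝 a, ‖f x‖ ≤ C * ‖x - a‖ ^ s := by
  rw [eventually_nhdsWithin_iff] at h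
  filter_upwards [h] with x hx
  by_cases hxa : x = a
  · subst hxa
    rw [h0, norm_zero]; positivity
  · exact hx hxa

theorem SymB.flat {a : E} (n : ℕ) : ∀ {F : Type} [NormedAddCommGroup F] [NormedSpace ℝ F]
    {s : ℝ} {f : E → F}, SymB a s n f → (n : ℝ) < s → f a = 0 → Flat a n f := by
  induction n with
  | zero =>
    intro F _ _ s f hf hs h0
    obtain ⟨C, hC, h⟩ := hf
    have hs' : 0 < s := by simpa using hs
    have hb := bound_full (f := f) (s := s) h0 hC (h.mono fun x hx => by simpa using hx.2 0 le_rfl)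
    have hca : ContinuousAt f a := by
      have := squeeze_zero_norm' hb (tendsto_aux hs' C)
      rw [ContinuousAt, h0]; exact this
    refine ⟨?_, ?_⟩
    · refine contDiffAt_zero.2 ⟨{x | ContinuousAt f x}, ?_, fun y hy => hy.continuousWithinAt⟩
      rw [eventually_nhdsWithin_iff] at h
      filter_upwards [h] with x hx
      by_cases hxa : x = a
      · subst hxa; exact hca
      · exact (hx hxa).1.continuousAt
    · intro l hl
      obtain rfl : l = 0 := by omega
      rw [← norm_eq_zero, norm_iteratedFDeriv_zero, h0, norm_zero]
  | succ n ih =>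
    intro F _ _ s f hf hs h0
    have hf' := hf.fderiv
    obtain ⟨C, hC, h⟩ := hf
    have hs1 : 0 < s - 1 := by
      push_cast at hs
      have : (0 : ℝ) ≤ n := by positivity
      linarith
    have hb := bound_full (f := f) (s := s) h0 hC (h.mono fun x hx => by simpa using hx.2 0 (by omega))
    have hda : HasFDerivAt f (0 : E →L[ℝ] F) a := by
      rw [hasFDerivAt_iff_isLittleO]
      rw [Asymptotics.isLittleO_iff]
      intro c hc
      have ht := (tendsto_aux (a := a) hs1 C).eventually (gt_mem_nhds hc)
      filter_upwards [hb, ht] with x hx hxt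
      simp only [h0, sub_zero, _root_.zero_apply]
      refine hx.trans ?_
      have : C * ‖x - a‖ ^ s = (C * ‖x - a‖ ^ (s - 1)) * ‖x - a‖ := by
        rcases eq_or_lt_of_le (norm_nonneg (x - a)) with hz | hz
        · rw [← hz, Real.zero_rpow (by linarith)]; simp
        · rw [mul_assoc, ← Real.rpow_add_one hz.ne']; simp
      rw [this]
      gcongr
    have hfd : _root_.fderiv ℝ f a = 0 := hda.fderiv
    obtain ⟨i1, i2⟩ := ih hf' (by push_cast at hs; linarith) hfd
    refine ⟨?_, ?_⟩
    · have := (contDiffAt_succ_iff_hasFDerivAt (𝕜 := ℝ) (f := f) (x := a) (n := n)).2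
        ⟨_root_.fderiv ℝ f, ⟨{x | DifferentiableAt ℝ f x}, ?_, fun y hy => hy.hasFDerivAt⟩, i1⟩
      · exact_mod_cast this
      · rw [eventually_nhdsWithin_iff] at h
        filter_upwards [h] with x hx
        by_cases hxa : x = a
        · subst hxa; exact hda.differentiableAt
        · exact (hx hxa).1.differentiableAt (by norm_cast)
    · intro l hl
      rcases l with _ | l
      · rw [← norm_eq_zero, norm_iteratedFDeriv_zero, h0, norm_zero]
      · rw [← norm_eq_zero, ← norm_iteratedFDeriv_fderiv, i2 l (by omega), norm_zero]

theorem Flat.smul {a : E} {n : ℕ} {f : E → ℝ} {g : E → F} (hf : Flat a n f)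
    (hg : ContDiffAt ℝ n g a) : Flat a n (fun x => f x • g x) := by
  refine ⟨hf.1.smul hg, fun l hl => ?_⟩
  have hl' : ((l : ℕ) : WithTop ℕ∞) ≤ n := by exact_mod_cast hl
  rw [← norm_le_zero_iff]
  refine (smul_bound (hf.1.of_le hl') (hg.of_le hl')).trans ?_
  refine (Finset.sum_eq_zero fun i hi => ?_).le
  have hi' : i ≤ l := by simpa [Nat.lt_succ_iff] using hi
  rw [hf.2 i (hi'.trans hl)]; simp
end SymB

section Inner
variable {E : Type} [NormedAddCommGroup E] [InnerProductSpace ℝ E]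

theorem hasFDerivAt_r {a x : E} (h : x ≠ a) :
    HasFDerivAt (fun y : E => ‖y - a‖) (‖x - a‖⁻¹ • innerSL ℝ (x - a)) x := by
  have hr : 0 < ‖x - a‖ := norm_pos_iff.2 (sub_ne_zero.2 h)
  have h1 : HasFDerivAt (fun y : E => ‖y - a‖ ^ 2) (2 • (innerSL ℝ (x - a))) x := by
    have := (hasStrictFDerivAt_norm_sq (x - a)).hasFDerivAt.comp x ((hasFDerivAt_id x).sub_const a)
    exact this
  have h2 := h1.sqrt (by positivity)
  simp only [Real.sqrt_sq (norm_nonneg _)] at h2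
  convert h2 using 1
  ext v
  simp
  field_simp

theorem sym_inner (a : E) (n : ℕ) : SymB a 1 n (fun x => innerSL ℝ (x - a)) := by
  have hb : ∀ᶠ x in 𝓝[≠] a, ‖innerSL ℝ (x - a)‖ ≤ 1 * ‖x - a‖ ^ (1 : ℝ) :=
    Eventually.of_forall fun x => by
      rw [innerSL_apply_norm, Real.rpow_one, one_mul]
  rcases n with _ | n
  · refine SymB.zero_of_bound zero_le_one (Eventually.of_forall fun x => ?_) hb
    fun_prop
  · refine SymB.of_fderiv (f' := fun _ => (innerSL ℝ : E →L[ℝ] E →L[ℝ] ℝ)) ?_ ?_ hb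
    · refine Eventually.of_forall fun x => ?_
      have := ((innerSL ℝ : E →L[ℝ] E →L[ℝ] ℝ).hasFDerivAt (x := x - a)).comp x
        ((hasFDerivAt_id x).sub_const a)
      exact this
    · rw [sub_self]; exact SymB.const _ _ _

theorem sym_rpow (a : E) (n : ℕ) : ∀ s : ℝ, SymB a s n (fun x => ‖x - a‖ ^ s) := by
  have hb : ∀ s : ℝ, ∀ᶠ x in 𝓝[≠] a, ‖‖x - a‖ ^ s‖ ≤ 1 * ‖x - a‖ ^ s := fun s =>
    Eventually.of_forall fun x => by
      rw [Real.norm_of_nonneg (by positivity), one_mul]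
  have hd : ∀ s : ℝ, ∀ᶠ x in 𝓝[≠] a, HasFDerivAt (fun x => ‖x - a‖ ^ s)
      (s • ‖x - a‖ ^ (s - 2) • innerSL ℝ (x - a)) x := fun s => by
    filter_upwards [self_mem_nhdsWithin] with x hx
    have hr : 0 < ‖x - a‖ := norm_pos_iff.2 (sub_ne_zero.2 hx)
    have := (hasFDerivAt_r hx).rpow_const (p := s) (Or.inl hr.ne')
    convert this using 1
    rw [smul_smul, smul_smul]
    congr 1
    rw [mul_assoc, ← div_eq_mul_inv, ← Real.rpow_sub_one hr.ne']
    congr 2; ring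
  induction n with
  | zero =>
    intro s
    exact SymB.zero_of_bound zero_le_one ((hd s).mono fun x hx => hx.continuousAt) (hb s)
  | succ n ih =>
    intro s
    refine SymB.of_fderiv (hd s) ?_ (hb s)
    have := (SymB.const a n s).smul ((ih (s - 2)).smul (sym_inner a n))
    convert this using 1; ring

theorem sym_u (a : E) {R : ℝ} (hR : 0 < R) (n : ℕ) : ∀ s : ℝ, 0 < s →
    SymB a s n (fun x => (max (1 / ‖x - a‖ - 1 / R) 0) ^ (-s)) := by
  have hnear : ∀ᶠ x in 𝓝[≠] a, 0 < ‖x - a‖ ∧ ‖x - a‖ < R / 2 := by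
    have h1 : ∀ᶠ x in 𝓝[≠] a, ‖x - a‖ < R / 2 := by
      refine eventually_nhdsWithin_of_eventually_nhds ?_
      filter_upwards [Metric.ball_mem_nhds a (half_pos hR)] with x hx
      simpa [dist_eq_norm] using hx
    filter_upwards [h1, self_mem_nhdsWithin] with x h1 hx
    exact ⟨norm_pos_iff.2 (sub_ne_zero.2 hx), h1⟩
  have key : ∀ r : ℝ, 0 < r → r < R / 2 → 1 / (2 * r) ≤ 1 / r - 1 / R := by
    intro r h0 h1
    have : 1 / R ≤ 1 / (2 * r) := one_div_le_one_div_of_le (by positivity) (by linarith)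
    have e : 1 / r = 1 / (2 * r) + 1 / (2 * r) := by field_simp; norm_num
    linarith
  have hb : ∀ s : ℝ, 0 < s → ∀ᶠ x in 𝓝[≠] a,
      ‖(max (1 / ‖x - a‖ - 1 / R) 0) ^ (-s)‖ ≤ 2 ^ s * ‖x - a‖ ^ s := fun s hs => by
    filter_upwards [hnear] with x hx
    have hk := key _ hx.1 hx.2
    have hp : 0 < 1 / (2 * ‖x - a‖) := by have := hx.1; positivity
    rw [max_eq_left (by linarith), Real.norm_of_nonneg (Real.rpow_nonneg (by linarith) _)]
    calc _ ≤ (1 / (2 * ‖x - a‖)) ^ (-s) :=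
          Real.rpow_le_rpow_of_nonpos hp hk (by linarith)
      _ = _ := by
          rw [one_div, Real.inv_rpow (by positivity), Real.rpow_neg (by positivity), inv_inv,
            Real.mul_rpow (by norm_num) (by positivity)]
  have hd : ∀ s : ℝ, 0 < s → ∀ᶠ x in 𝓝[≠] a,
      HasFDerivAt (fun x => (max (1 / ‖x - a‖ - 1 / R) 0) ^ (-s))
      (s • (max (1 / ‖x - a‖ - 1 / R) 0) ^ (-(s + 1)) • ‖x - a‖ ^ (-3 : ℝ) •
        innerSL ℝ (x - a)) x := fun s hs => by
    filter_upwards [nhdsNE_nhds hnear, self_mem_nhdsWithin] with x hxe hne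
    have hx := hxe.self_of_nhds
    have hk := key _ hx.1 hx.2
    have hp : 0 < 1 / (2 * ‖x - a‖) := by have := hx.1; positivity
    have e : (fun x => (max (1 / ‖x - a‖ - 1 / R) 0) ^ (-s)) =ᶠ[𝓝 x]
        fun x => (‖x - a‖⁻¹ - 1 / R) ^ (-s) := by
      filter_upwards [hxe] with y hy
      have hk := key _ hy.1 hy.2
      have hp : 0 < 1 / (2 * ‖y - a‖) := by have := hy.1; positivity
      rw [max_eq_left (by linarith), one_div]
    refine HasFDerivAt.congr_of_eventuallyEq ?_ e
    have h1 : HasFDerivAt (fun y : E => ‖y - a‖⁻¹ - 1 / R) _ x :=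
      (((hasDerivAt_inv hx.1.ne').comp_hasFDerivAt x (hasFDerivAt_r hne)).sub_const (1 / R))
    have h2 := h1.rpow_const (p := -s) (Or.inl (by rw [← one_div]; linarith))
    convert h2 using 1
    rw [max_eq_left (by linarith)]
    simp only [smul_smul, one_div]
    congr 1
    rw [Real.rpow_neg hx.1.le, show (-(s + 1)) = -s - 1 by ring]
    have : ‖x - a‖ ^ (3 : ℝ) = ‖x - a‖ ^ 3 := by exact_mod_cast Real.rpow_natCast _ 3
    rw [this]
    have := hx.1
    field_simp
  induction n with
  | zero =>
    intro s hs
    exact SymB.zero_of_bound (by positivity) ((hd s hs).mono fun x hx => hx.continuousAt) (hb s hs)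
  | succ n ih =>
    intro s hs
    refine SymB.of_fderiv (hd s hs) ?_ (hb s hs)
    have := (SymB.const a n s).smul ((ih (s + 1) (by linarith)).smul
      ((sym_rpow a n (-3)).smul (sym_inner a n)))
    convert this using 1; ring
end Inner

theorem contDiff_maxpow (n : ℕ) : ∀ μ : ℝ, (n : ℝ) < μ →
    ContDiff ℝ n (fun t : ℝ => (max t 0) ^ μ) := by
  induction n with
  | zero =>
    intro μ hμ
    have : 0 < μ := by simpa using hμ
    refine contDiff_zero.2 (continuous_iff_continuousAt.2 fun t => ?_)
    exact ContinuousAt.rpow_const (by fun_prop) (Or.inr this.le)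
  | succ n ih =>
    intro μ hμ
    push_cast at hμ
    have hn : (0 : ℝ) ≤ n := by positivity
    have hd : ∀ t : ℝ, HasDerivAt (fun t : ℝ => (max t 0) ^ μ) (μ * (max t 0) ^ (μ - 1)) t := by
      intro t
      rcases lt_trichotomy t 0 with h | h | h
      · rw [max_eq_right h.le, Real.zero_rpow (by linarith), mul_zero]
        refine (hasDerivAt_const t (0 : ℝ)).congr_of_eventuallyEq ?_
        filter_upwards [gt_mem_nhds h] with y hy
        rw [max_eq_right hy.le, Real.zero_rpow (by linarith)]
      · subst h
        rw [max_self, Real.zero_rpow (by linarith), mul_zero]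
        have hz : (0:ℝ) ^ μ = 0 := Real.zero_rpow (by linarith)
        have h1 : HasDerivAt (fun t : ℝ => |t| ^ μ) 0 0 := by simpa using hasDerivAt_abs_rpow 0 (p := μ) (by linarith)
        rw [hasDerivAt_iff_isLittleO] at h1 ⊢
        refine Asymptotics.IsBigO.trans_isLittleO ?_ h1
        refine Asymptotics.IsBigO.of_bound 1 (Eventually.of_forall fun y => ?_)
        simp only [max_self, abs_zero, hz, sub_zero, smul_zero, one_mul]
        rw [Real.norm_of_nonneg (by positivity), Real.norm_of_nonneg (by positivity)]
        exact Real.rpow_le_rpow (by positivity) (max_le (le_abs_self y) (abs_nonneg y)) (by linarith)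
      · rw [max_eq_left h.le]
        refine (Real.hasDerivAt_rpow_const (Or.inl h.ne')).congr_of_eventuallyEq ?_
        filter_upwards [lt_mem_nhds h] with y hy
        rw [max_eq_left hy.le]
    have := (contDiff_succ_iff_deriv (𝕜 := ℝ) (n := n) (f := fun t : ℝ => (max t 0) ^ μ)).2
      ⟨fun t => (hd t).differentiableAt, by simp, ?_⟩
    · exact_mod_cast this
    · rw [show deriv (fun t : ℝ => (max t 0) ^ μ) = fun t => μ * (max t 0) ^ (μ - 1) from
        funext fun t => (hd t).deriv]
      exact contDiff_const.mul (ih (μ - 1) (by linarith))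

/-- Flatness up to a constant. -/
def FlatC (a : E2) (n : ℕ) (f : E2 → ℝ) : Prop :=
  ContDiffAt ℝ n f a ∧ ∀ l, 1 ≤ l → l ≤ n → iteratedFDeriv ℝ l f a = 0

theorem FlatC.dv {a : E2} {n : ℕ} {f : E2 → ℝ} (h : FlatC a (n + 1) f) (v : E2) :
    FlatC a n (Dv v f) ∧ Dv v f a = 0 ∧ DifferentiableAt ℝ f a := by
  obtain ⟨h1, h2⟩ := h
  have h3 : ContDiffAt ℝ n (fderiv ℝ f) a := h1.fderiv_right (by norm_cast)
  have e : Dv v f = (ContinuousLinearMap.apply ℝ ℝ v) ∘ (fderiv ℝ f) := rfl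
  have h0 : fderiv ℝ f a = 0 := by
    rw [← norm_eq_zero, ← norm_iteratedFDeriv_zero (𝕜 := ℝ), norm_iteratedFDeriv_fderiv,
      h2 _ (by omega) (by omega), norm_zero]
  refine ⟨⟨?_, ?_⟩, ?_, h1.differentiableAt (by norm_cast)⟩
  · rw [e]
    exact (ContinuousLinearMap.contDiff _).contDiffAt.comp a h3
  · intro l hl hln
    rw [e, ← norm_le_zero_iff]
    refine (ContinuousLinearMap.norm_iteratedFDeriv_comp_left _ h3 (by exact_mod_cast hln)).trans ?_
    rw [norm_iteratedFDeriv_fderiv, h2 _ (by omega) (by omega), norm_zero, mul_zero]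
  · simp [Dv, h0]

theorem FlatC.iter {a : E2} (v : E2) {n : ℕ} (b : ℕ) : ∀ {f : E2 → ℝ}, FlatC a (n + b) f →
    FlatC a n ((Dv v)^[b] f) := by
  induction b with
  | zero => intro f h; exact h
  | succ b ih =>
    intro f h
    rw [Function.iterate_succ_apply]
    exact ih (h.dv v).1

theorem FlatC.mono {a : E2} {m n : ℕ} {f : E2 → ℝ} (h : FlatC a n f) (hm : m ≤ n) : FlatC a m f :=
  ⟨h.1.of_le (by exact_mod_cast hm), fun l h1 h2 => h.2 l h1 (h2.trans hm)⟩

theorem FlatC.pd_main {a : E2} {α β : ℕ} (h1 : 1 ≤ α + β) {f : E2 → ℝ} (h : FlatC a (α + β) f) :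
    (∀ b < β, DifferentiableAt ℝ (pd 0 b f) a) ∧
    (∀ c < α, DifferentiableAt ℝ (pd c β f) a) ∧ pd α β f a = 0 := by
  refine ⟨?_, ?_, ?_⟩
  · intro b hb
    have h' : FlatC a (0 + 1) ((Dv e1)^[b] f) := (h.mono (by omega)).iter e1 b
    exact (h'.dv e0).2.2
  · intro c hc
    have h' : FlatC a (0 + 1 + c) ((Dv e1)^[β] f) := (h.mono (by omega)).iter e1 β
    exact ((h'.iter e0 c).dv e0).2.2
  · rcases α with _ | c
    · obtain ⟨b, rfl⟩ : ∃ b, β = b + 1 := ⟨β - 1, by omega⟩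
      have h' : FlatC a (0 + 1) ((Dv e1)^[b] f) := (h.mono (by omega)).iter e1 b
      have := (h'.dv e1).2.1
      rw [← Function.iterate_succ_apply' (Dv e1)] at this
      exact this
    · have h' : FlatC a (0 + 1 + c) ((Dv e1)^[β] f) := (h.mono (by omega)).iter e1 β
      have := ((h'.iter e0 c).dv e0).2.1
      rw [← Function.iterate_succ_apply' (Dv e0)] at this
      exact this

theorem Flat.flatC {a : E2} {n : ℕ} {f g : E2 → ℝ} {c : ℝ} (h : Flat a n g)
    (e : f =ᶠ[𝓝 a] fun x => c + g x) : FlatC a n f := by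
  refine ⟨(contDiffAt_const.add h.1).congr_of_eventuallyEq e, fun l h1 hl => ?_⟩
  rw [(e.iteratedFDeriv ℝ l).self_of_nhds]
  have := iteratedFDeriv_add_apply (𝕜 := ℝ) (i := l) (f := fun _ : E2 => c) (g := g) (x := a)
    contDiffAt_const (h.1.of_le (by exact_mod_cast hl))
  rw [h.2 l hl, iteratedFDeriv_const_of_ne (by omega)] at this
  rw [Pi.zero_apply, add_zero] at this
  exact this

theorem Wloc_nonneg (N : ℕ) (p : Fin N → E2) (R : Fin N → ℝ) (μ : ℝ) (j : Fin N) (x : E2) :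
    0 ≤ Wloc N p R μ j x := Real.rpow_nonneg (le_max_right _ _) _

theorem Wloc_contDiffAt (N : ℕ) (p : Fin N → E2) (R : Fin N → ℝ) (μ : ℝ) (j : Fin N) (x : E2)
    (hx : x ≠ p j) (n : ℕ) (hn : (n : ℝ) < μ) : ContDiffAt ℝ n (Wloc N p R μ j) x := by
  have h1 : ContDiffAt ℝ n (fun x => 1 / ‖x - p j‖ - 1 / R j) x := by
    have h2 : ContDiffAt ℝ n (fun x => ‖x - p j‖) x :=
      (contDiffAt_id.sub contDiffAt_const).norm ℝ (sub_ne_zero.2 hx)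
    exact (contDiffAt_const.div h2 (norm_ne_zero_iff.2 (sub_ne_zero.2 hx))).sub contDiffAt_const
  exact (contDiff_maxpow n μ hn).contDiffAt.comp x h1

theorem WtExt_flatC (N : ℕ) (p : Fin N → E2)
    (hp : Function.Injective p) (μ : ℝ) (hμ : 0 < μ)
    (R : Fin N → ℝ) (hR : ∀ j, 0 < R j) (n : ℕ) (hn : (n : ℝ) < μ) (i k : Fin N) :
    FlatC (p k) n (WtExt N p R μ i) := by
  set u : E2 → ℝ := fun x => (max (1 / ‖x - p k‖ - 1 / R k) 0) ^ (-μ) with hu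
  have huW : ∀ x, u x = (Wloc N p R μ k x)⁻¹ := fun x => by
    rw [hu, Wloc]; exact Real.rpow_neg (le_max_right _ _) _
  have hu0 : u (p k) = 0 := by
    have : max (-(R k)⁻¹) 0 = 0 := max_eq_right (by have := hR k; simp [this.le])
    simp [hu, this, Real.zero_rpow (neg_ne_zero.2 hμ.ne')]
  have hflat : Flat (p k) n u := (sym_u (p k) (hR k) n μ hμ).flat n hn hu0
  set S : E2 → ℝ := fun x => ∑ j ∈ Finset.univ.erase k, Wloc N p R μ j x with hS
  have hSc : ContDiffAt ℝ n S (p k) := by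
    refine ContDiffAt.sum fun j hj => Wloc_contDiffAt N p R μ j _ ?_ n hn
    intro h
    exact (Finset.ne_of_mem_erase hj) (hp h).symm
  have hS0 : ∀ x, 0 ≤ S x := fun x => Finset.sum_nonneg fun j _ => Wloc_nonneg N p R μ j x
  have hu_nn : ∀ x, 0 ≤ u x := fun x => Real.rpow_nonneg (le_max_right _ _) _
  have hden : ∀ x, 0 < 1 + u x * S x := fun x => by
    have := mul_nonneg (hu_nn x) (hS0 x); linarith
  have hdc : ContDiffAt ℝ n (fun x => 1 + u x * S x) (p k) :=
    contDiffAt_const.add (hflat.1.mul hSc)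
  have hnode : ∀ᶠ x in 𝓝 (p k), ∀ j, x = p j → j = k := by
    rw [eventually_all]
    intro j
    by_cases hj : j = k
    · simp [hj]
    · filter_upwards [isOpen_ne.mem_nhds (fun h => hj (hp h).symm : p k ≠ p j)] with x hx h
      exact absurd h hx
  have hpos : ∀ᶠ x in 𝓝 (p k), x ≠ p k → 0 < Wloc N p R μ k x := by
    filter_upwards [Metric.ball_mem_nhds (p k) (hR k)] with x hx hne
    have hr : 0 < ‖x - p k‖ := norm_pos_iff.2 (sub_ne_zero.2 hne)
    have hx' : ‖x - p k‖ < R k := by simpa [dist_eq_norm] using hx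
    have := one_div_lt_one_div_of_lt hr hx'
    exact Real.rpow_pos_of_pos (lt_max_of_lt_left (by linarith)) _
  have hsum : ∀ x, ∑ j, Wloc N p R μ j x = Wloc N p R μ k x + S x := fun x =>
    (Finset.add_sum_erase _ _ (Finset.mem_univ k)).symm
  by_cases hik : i = k
  · subst hik
    have hG : ContDiffAt ℝ n (fun x => -S x / (1 + u x * S x)) (p i) :=
      hSc.neg.div hdc (hden _).ne'
    refine (hflat.smul hG).flatC (c := 1) ?_
    filter_upwards [hnode, hpos] with x hx hW
    by_cases hxa : x = p i
    · subst hxa; simp [WtExt, hu0]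
    · have hno : ¬ ∃ j, x = p j := by
        rintro ⟨j, hj⟩
        exact hxa (hx j hj ▸ hj)
      have hd := hden x
      have hW := hW hxa
      have hs := hS0 x
      simp only [WtExt, if_neg hxa, if_neg hno, hsum, smul_eq_mul]
      rw [huW] at hd ⊢
      field_simp
      ring
  · have hG : ContDiffAt ℝ n (fun x => Wloc N p R μ i x / (1 + u x * S x)) (p k) :=
      (Wloc_contDiffAt N p R μ i _ (fun h => hik (hp h).symm) n hn).div hdc (hden _).ne'
    refine (hflat.smul hG).flatC (c := 0) ?_
    filter_upwards [hnode, hpos] with x hx hW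
    have hxi : x ≠ p i := fun h => hik (hx i h)
    by_cases hxa : x = p k
    · have hex : ∃ j, x = p j := ⟨k, hxa⟩
      simp only [WtExt, if_neg hxi, if_pos hex]
      subst hxa; simp [hu0]
    · have hno : ¬ ∃ j, x = p j := by
        rintro ⟨j, hj⟩
        exact hxa (hx j hj ▸ hj)
      have hd := hden x
      have hW := hW hxa
      have hs := hS0 x
      simp only [WtExt, if_neg hxi, if_neg hno, hsum, smul_eq_mul]
      rw [huW] at hd ⊢
      field_simp
      ring

/-- **Vanishing of the partial derivatives of the local Shepard basis functions
at the nodes.** For all integers `α, β ≥ 0` with `1 ≤ α + β < μ` and all nodes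
`p k`, the partial derivative `∂^{α+β} W̃_{μ,i}/∂x^α ∂y^β` exists at `p k`
(each lower-order iterate is differentiable there) and equals `0`. -/
theorem local_shepard_basis_deriv_zero (N : ℕ) (p : Fin N → E2)
    (hp : Function.Injective p) (μ : ℝ) (hμ : 0 < μ)
    (R : Fin N → ℝ) (hR : ∀ j, 0 < R j)
    (hden : ∀ k : Fin N, ∀ᶠ x in nhdsWithin (p k) {x | ∀ j, x ≠ p j},
      0 < ∑ j, Wloc N p R μ j x)
    (α β : ℕ) (hαβ1 : 1 ≤ α + β) (hαβμ : (α + β : ℝ) < μ) (i k : Fin N) :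
    (∀ b < β, DifferentiableAt ℝ (pd 0 b (WtExt N p R μ i)) (p k)) ∧
    (∀ a < α, DifferentiableAt ℝ (pd a β (WtExt N p R μ i)) (p k)) ∧
    pd α β (WtExt N p R μ i) (p k) = 0 := by
  exact (WtExt_flatC N p hp μ hμ R hR (α + β) (by exact_mod_cast hαβμ) i k).pd_main hαβ1
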